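/- Let π* be the unique minimizer of F_α over Δ_m and let q* be a minimizer of J_α over B_∞. For q ∈ R^n let π(q) ∈ Δ_m be the softmax π(q)_j = exp(−(Mᵀq)_j/α) / Σ_{k=1}^m exp(−(Mᵀq)_k/α). Then for every q ∈ B_∞: ‖π(q) − π*‖_{ℓ¹}² ≤ (2/α) ( J_α(q) − J_α(q*) ). -/

import Mathlib

lemma aux_hasDeriv (x : ℝ) (hx : 0 < x) :
    HasDerivAt (fun x : ℝ => Real.log x - (5*x^2-4*x-1) / (2*x^2+4*x))
      ((x-1)^3 / (x^2*(x+2)^2)) x := by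
  have h1 := Real.hasDerivAt_log hx.ne'
  have hN : HasDerivAt (fun x : ℝ => 5*x^2-4*x-1) (10*x-4) x := by
    have := ((((hasDerivAt_id x).pow 2).const_mul 5).sub ((hasDerivAt_id x).const_mul 4)).sub_const 1
    exact this.congr_deriv (by simp; ring)
  have hD : HasDerivAt (fun x : ℝ => 2*x^2+4*x) (4*x+4) x := by
    have := (((hasDerivAt_id x).pow 2).const_mul 2).add ((hasDerivAt_id x).const_mul 4)
    exact this.congr_deriv (by simp; ring)
  have h0 : 2*x^2+4*x ≠ 0 := by positivity
  refine (h1.sub (hN.div hD h0)).congr_deriv ?_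
  have h2 : x + 2 ≠ 0 := by positivity
  have h3 : 2*x^2+4*x = 2*x*(x+2) := by ring
  rw [h3]
  field_simp
  ring

lemma aux_log (x : ℝ) (hx : 0 < x) : (5*x^2-4*x-1) / (2*x^2+4*x) ≤ Real.log x := by
  have key : (fun x : ℝ => Real.log x - (5*x^2-4*x-1) / (2*x^2+4*x)) 1 ≤
      (fun x : ℝ => Real.log x - (5*x^2-4*x-1) / (2*x^2+4*x)) x := by
    rcases le_total x 1 with h | h
    · have := antitoneOn_of_deriv_nonpos (convex_Icc x 1)
        (f := fun x : ℝ => Real.log x - (5*x^2-4*x-1) / (2*x^2+4*x))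
        (fun y hy => (aux_hasDeriv y (by linarith [hy.1])).continuousAt.continuousWithinAt)
        (fun y hy => by
          rw [interior_Icc] at hy
          exact (aux_hasDeriv y (by linarith [hy.1])).differentiableAt.differentiableWithinAt)
        (fun y hy => by
          rw [interior_Icc] at hy
          rw [(aux_hasDeriv y (by linarith [hy.1])).deriv]
          apply div_nonpos_of_nonpos_of_nonneg _ (by positivity)
          have : 0 ≤ (1-y)^3 := pow_nonneg (by linarith [hy.2]) 3
          nlinarith)
      exact this ⟨le_refl _, h⟩ ⟨h, le_refl _⟩ h
    · have := monotoneOn_of_deriv_nonneg (convex_Icc 1 x)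
        (f := fun x : ℝ => Real.log x - (5*x^2-4*x-1) / (2*x^2+4*x))
        (fun y hy => (aux_hasDeriv y (by linarith [hy.1])).continuousAt.continuousWithinAt)
        (fun y hy => by
          rw [interior_Icc] at hy
          exact (aux_hasDeriv y (by linarith [hy.1])).differentiableAt.differentiableWithinAt)
        (fun y hy => by
          rw [interior_Icc] at hy
          rw [(aux_hasDeriv y (by linarith [hy.1])).deriv]
          have : 0 ≤ (y-1)^3 := pow_nonneg (by linarith [hy.1]) 3
          positivity)
      exact this ⟨le_refl _, h⟩ ⟨h, le_refl _⟩ h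
  norm_num at key
  linarith

lemma aux_pt (p q : ℝ) (hp : 0 ≤ p) (hq : 0 < q) :
    3 * (p-q)^2 / (p+2*q) ≤ 2 * (p * Real.log p - p * Real.log q - p + q) := by
  rcases hp.eq_or_lt with rfl | hp
  · have : 3 * (0-q)^2 / (0+2*q) = 3/2*q := by field_simp; ring
    rw [this]; simp; linarith
  · have h := aux_log (p/q) (by positivity)
    rw [Real.log_div hp.ne' hq.ne'] at h
    have h2 := mul_le_mul_of_nonneg_left h (by positivity : 0 ≤ 2 * p)
    have : 2 * p * ((5*(p/q)^2-4*(p/q)-1) / (2*(p/q)^2+4*(p/q))) =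
        3 * (p-q)^2 / (p+2*q) + 2*p - 2*q := by
      have e : 2*(p/q)^2+4*(p/q) = 2*p*(p+2*q)/q^2 := by field_simp; ring
      rw [e]
      field_simp
      ring
    linarith

lemma aux_pinsker {m : ℕ} (p q : Fin m → ℝ) (hp : ∀ j, 0 ≤ p j) (hq : ∀ j, 0 < q j)
    (hps : ∑ j, p j = 1) (hqs : ∑ j, q j = 1) :
    (∑ j, |q j - p j|)^2 ≤ 2 * (∑ j, p j * Real.log (p j) - ∑ j, p j * Real.log (q j)) := by
  have hpos : ∀ j, 0 < (p j + 2 * q j) := fun j => by linarith [hp j, hq j]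
  have h1 := Finset.sum_sq_le_sum_mul_sum_of_sq_le_mul Finset.univ
    (r := fun j => |q j - p j|) (f := fun j => (p j + 2 * q j)/3)
    (g := fun j => 3 * (p j - q j)^2 / (p j + 2 * q j))
    (fun j _ => by have := hpos j; positivity) (fun j _ => by have := hpos j; positivity)
    (fun j _ => by
      have := (hpos j).ne'
      have e : (p j + 2 * q j)/3 * (3 * (p j - q j)^2 / (p j + 2 * q j)) = (p j - q j)^2 := by
        generalize p j + 2 * q j = w at *
        field_simp
      rw [e, sq_abs]; apply le_of_eq; ring)
  have h2 : ∑ j, (p j + 2 * q j)/3 = 1 := by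
    rw [← Finset.sum_div, Finset.sum_add_distrib, ← Finset.mul_sum, hps, hqs]; norm_num
  rw [h2, one_mul] at h1
  refine h1.trans ((Finset.sum_le_sum fun j _ => aux_pt (p j) (q j) (hp j) (hq j)).trans ?_)
  rw [← Finset.mul_sum, Finset.sum_add_distrib, Finset.sum_sub_distrib, Finset.sum_sub_distrib,
    hps, hqs]
  linarith

/-- distance of the softmax iterate to the primal solution is controlled by
the dual gap. If `πs` minimizes `F_α` over the simplex and `qs` minimizes `J_α` over the
unit `ℓ^∞` ball `B`, then for every `q ∈ B`,
`‖π(q) − πs‖_{ℓ¹}² ≤ (2/α) (J_α(q) − J_α(qs))`, where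
`π(q)_j = exp(−(Mᵀq)_j/α) / ∑_k exp(−(Mᵀq)_k/α)`. -/
theorem stmt12 (n m : ℕ) (hm : 0 < m)
    (M : Matrix (Fin n) (Fin m) ℝ) (p : Fin n → ℝ) (α : ℝ) (hα : 0 < α) :
    let F : (Fin m → ℝ) → ℝ := fun π =>
      (∑ i, |M.mulVec π i - p i|) + α * ∑ j, π j * Real.log (π j)
    let J : (Fin n → ℝ) → ℝ := fun q =>
      (∑ i, p i * q i) + α * Real.log (∑ k, Real.exp (-(M.transpose.mulVec q k) / α))
    let B : Set (Fin n → ℝ) := {q | ∀ i, |q i| ≤ 1}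
    let πq : (Fin n → ℝ) → (Fin m → ℝ) := fun q j =>
      Real.exp (-(M.transpose.mulVec q j) / α) /
        ∑ k, Real.exp (-(M.transpose.mulVec q k) / α)
    ∀ πs ∈ stdSimplex ℝ (Fin m), (∀ π ∈ stdSimplex ℝ (Fin m), F πs ≤ F π) →
    ∀ qs ∈ B, (∀ q ∈ B, J qs ≤ J q) →
      ∀ q ∈ B, (∑ j, |πq q j - πs j|) ^ 2 ≤ 2 / α * (J q - J qs) := by
  intro F J B πq πs hπs hmin qs hqs hJ q hq
  have : Nonempty (Fin m) := ⟨⟨0, hm⟩⟩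
  have hZ : ∀ q : Fin n → ℝ, 0 < ∑ k, Real.exp (-(M.transpose.mulVec q k) / α) := fun q =>
    Finset.sum_pos (fun _ _ => Real.exp_pos _) Finset.univ_nonempty
  have hpos : ∀ q j, 0 < πq q j := fun q j => div_pos (Real.exp_pos _) (hZ q)
  have hsum : ∀ q, ∑ j, πq q j = 1 := fun q => by
    simp only [πq]
    rw [← Finset.sum_div, div_self (hZ q).ne']
  have hsimp : ∀ q, πq q ∈ stdSimplex ℝ (Fin m) := fun q => ⟨fun j => (hpos q j).le, hsum q⟩
  -- identity
  have hid : ∀ q : Fin n → ℝ, ∀ π ∈ stdSimplex ℝ (Fin m),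
      α * (∑ j, π j * Real.log (π j) - ∑ j, π j * Real.log (πq q j)) =
        α * ∑ j, π j * Real.log (π j) + ∑ i, (M.mulVec π i - p i) * q i + J q := by
    intro q π hπ
    have e1 : ∀ j, π j * Real.log (πq q j) = -(π j * M.transpose.mulVec q j) / α -
        π j * Real.log (∑ k, Real.exp (-(M.transpose.mulVec q k) / α)) := by
      intro j
      simp only [πq]
      rw [Real.log_div (Real.exp_pos _).ne' (hZ q).ne', Real.log_exp]
      ring
    have e2 : ∑ j, π j * M.transpose.mulVec q j = ∑ i, M.mulVec π i * q i := by
      have := Matrix.dotProduct_mulVec π M.transpose q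
      rw [Matrix.vecMul_transpose] at this
      exact this
    rw [Finset.sum_congr rfl fun j _ => e1 j, Finset.sum_sub_distrib, ← Finset.sum_mul, hπ.2,
      ← Finset.sum_div, Finset.sum_neg_distrib, e2]
    simp only [J, sub_mul, Finset.sum_sub_distrib]
    field_simp
    ring
  have hpin : ∀ q : Fin n → ℝ, ∀ π ∈ stdSimplex ℝ (Fin m),
      α * (∑ j, |πq q j - π j|)^2 ≤
        2 * (α * ∑ j, π j * Real.log (π j) + ∑ i, (M.mulVec π i - p i) * q i + J q) := by
    intro q π hπ
    have := mul_le_mul_of_nonneg_left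
      (aux_pinsker π (πq q) hπ.1 (hpos q) hπ.2 (hsum q)) hα.le
    rw [← hid q π hπ]
    linarith
  have hself : ∀ q, α * ∑ j, πq q j * Real.log (πq q j) +
      ∑ i, (M.mulVec (πq q) i - p i) * q i + J q = 0 := fun q => by
    rw [← hid q _ (hsimp q)]; simp
  -- first order condition
  have hfoc : ∑ i, |M.mulVec (πq qs) i - p i| ≤ ∑ i, (M.mulVec (πq qs) i - p i) * qs i := by
    set s : Fin n → ℝ := fun i => SignType.sign (M.mulVec (πq qs) i - p i) with hs
    have hsB : ∀ i, |s i| ≤ 1 := by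
      intro i
      simp only [hs]
      rcases SignType.sign (M.mulVec (πq qs) i - p i) with _ | _ | _ <;> simp
    let c : ℝ → (Fin n → ℝ) := fun t i => qs i + t * (s i - qs i)
    have hc0 : c 0 = qs := by funext i; simp [c]
    let g : ℝ → ℝ := fun t => ∑ i, (M.mulVec (πq (c t)) i - p i) * (s i - qs i)
    have hcont : Continuous g := by
      have hc : Continuous c := by fun_prop
      have hMq : ∀ k, Continuous fun t => M.transpose.mulVec (c t) k := fun k =>
        (continuous_apply k).comp (Continuous.matrix_mulVec continuous_const hc)
      have hπc : Continuous fun t => πq (c t) := by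
        refine continuous_pi fun j => ?_
        refine Continuous.div ?_ ?_ (fun t => (hZ _).ne')
        · exact Real.continuous_exp.comp ((hMq j).neg.div_const α)
        · exact continuous_finsetSum _ fun k _ =>
            Real.continuous_exp.comp ((hMq k).neg.div_const α)
      have hMπ : Continuous fun t => M.mulVec (πq (c t)) :=
        Continuous.matrix_mulVec continuous_const hπc
      refine continuous_finsetSum _ fun i _ => ?_
      exact ((((continuous_apply i).comp hMπ).sub continuous_const).mul continuous_const)
    have hle : ∀ t ∈ Set.Ioc (0:ℝ) 1, g t ≤ 0 := by
      intro t ht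
      have hcB : c t ∈ B := by
        intro i
        have a := abs_le.1 (hsB i)
        have b := abs_le.1 (hqs i)
        have h0 := ht.1
        have h1 := ht.2
        simp only [c]
        rw [abs_le]
        constructor <;> nlinarith
      have h1 := hJ _ hcB
      have h2 := hself (c t)
      have h3 := hpin qs _ (hsimp (c t))
      have h4 : 0 ≤ α * (∑ j, |πq qs j - πq (c t) j|)^2 := by positivity
      have h5 : ∑ i, (M.mulVec (πq (c t)) i - p i) * c t i =
          ∑ i, (M.mulVec (πq (c t)) i - p i) * qs i + t * g t := by
        simp only [g]
        rw [Finset.mul_sum, ← Finset.sum_add_distrib]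
        exact Finset.sum_congr rfl fun i _ => by simp only [c]; ring
      have h6 : t * g t ≤ 0 := by linarith
      by_contra hg
      push Not at hg
      linarith [mul_pos ht.1 hg]
    have h0 : g 0 ≤ 0 := by
      have ht : Filter.Tendsto g (nhdsWithin 0 (Set.Ioi 0)) (nhds (g 0)) :=
        hcont.continuousAt.tendsto.mono_left nhdsWithin_le_nhds
      refine le_of_tendsto ht ?_
      filter_upwards [Ioc_mem_nhdsGT (zero_lt_one' ℝ)] with t ht
      exact hle t ht
    simp only [g, hc0, mul_sub, Finset.sum_sub_distrib] at h0
    have h7 : ∑ i, (M.mulVec (πq qs) i - p i) * s i = ∑ i, |M.mulVec (πq qs) i - p i| :=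
      Finset.sum_congr rfl fun i _ => by simp only [hs]; exact self_mul_sign _
    linarith
  have hF := hmin _ (hsimp qs)
  have hs := hself qs
  have hP := hpin q πs hπs
  have hH : ∑ i, (M.mulVec πs i - p i) * q i ≤ ∑ i, |M.mulVec πs i - p i| := by
    refine Finset.sum_le_sum fun i _ => ?_
    calc _ ≤ |(M.mulVec πs i - p i) * q i| := le_abs_self _
      _ = |M.mulVec πs i - p i| * |q i| := abs_mul _ _
      _ ≤ _ := mul_le_of_le_one_right (abs_nonneg _) (hq i)
  simp only [F] at hF
  have hfin : α * (∑ j, |πq q j - πs j|)^2 ≤ 2 * (J q - J qs) := by linarith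
  rw [div_mul_eq_mul_div, le_div_iff₀ hα]
  linarith
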